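/- There is a constant C (independent of the formula) such that for every PML formula φ of modal depth at most 1 in which only the modalities E_in and E_out occur (φ ∈ PML₁^E), there exist an MPNN M_φ ∈ M_mean with at most C·(deg(φ)+1) layers and a natural number e ≤ C·(deg(φ)+1) such that M_φ recognises φ over the class of all regular pointed graphs (G,v) whose focus v is strongly marked by colour p, with certainty c(|V|) = 1/|V|^e. -/

import Mathlib

namespace PMLMPNN

/-- Modalities of Peano modal logic. -/
inductive Modality where
  | id | ein | eout | top
deriving DecidableEq

/-- A normalised integer inequality `∑ i, a i * ∏ (mon i) ≤ b`. -/
structure PeanoIneq (m : ℕ) where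
  K : ℕ
  a : Fin K → ℤ
  mon : Fin K → List (Fin m)
  b : ℤ

/-- Value of a monomial (a list of variables) under an assignment. -/
def monValZ {m : ℕ} (c : Fin m → ℕ) (l : List (Fin m)) : ℤ :=
  (l.map (fun j => (c j : ℤ))).prod

def PeanoIneq.sat {m : ℕ} (t : PeanoIneq m) (c : Fin m → ℕ) : Bool :=
  decide ((∑ i, t.a i * monValZ c (t.mon i)) ≤ t.b)

def PeanoIneq.deg {m : ℕ} (t : PeanoIneq m) : ℕ :=
  Finset.univ.sup (fun i => (t.mon i).length)

/-- Peano formulas: Boolean combinations of normalised inequalities. -/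
inductive PeanoFormula (m : ℕ) where
  | ineq : PeanoIneq m → PeanoFormula m
  | not : PeanoFormula m → PeanoFormula m
  | and : PeanoFormula m → PeanoFormula m → PeanoFormula m

def PeanoFormula.sat {m : ℕ} (c : Fin m → ℕ) : PeanoFormula m → Bool
  | .ineq t => t.sat c
  | .not ψ => ! ψ.sat c
  | .and ψ₁ ψ₂ => ψ₁.sat c && ψ₂.sat c

def PeanoFormula.deg {m : ℕ} : PeanoFormula m → ℕ
  | .ineq t => t.deg
  | .not ψ => ψ.deg
  | .and ψ₁ ψ₂ => max ψ₁.deg ψ₂.deg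

/-- A term is homogeneous if it has no constant part and all its monomials
have the same degree. -/
def PeanoIneq.Homog {m : ℕ} (t : PeanoIneq m) : Prop :=
  t.b = 0 ∧ ∀ i, (t.mon i).length = t.deg

def PeanoFormula.Homog {m : ℕ} : PeanoFormula m → Prop
  | .ineq t => t.Homog
  | .not ψ => ψ.Homog
  | .and ψ₁ ψ₂ => ψ₁.Homog ∧ ψ₂.Homog

/-- The set of monomials occurring in a Peano formula. -/
def PeanoFormula.mons {m : ℕ} : PeanoFormula m → Finset (List (Fin m))
  | .ineq t => Finset.univ.image t.mon
  | .not ψ => ψ.mons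
  | .and ψ₁ ψ₂ => ψ₁.mons ∪ ψ₂.mons

/-- The set of constants occurring in a Peano formula. -/
def PeanoFormula.consts {m : ℕ} : PeanoFormula m → Finset ℤ
  | .ineq t => {t.b}
  | .not ψ => ψ.consts
  | .and ψ₁ ψ₂ => ψ₁.consts ∪ ψ₂.consts

/-- PML formulas over `k` colours (propositions). -/
inductive PML (k : ℕ) where
  | prop : Fin k → PML k
  | not : PML k → PML k
  | and : PML k → PML k → PML k
  | modal : (m : ℕ) → (Fin m → Modality) → PeanoFormula m → (Fin m → PML k) → PML k

def PML.md {k : ℕ} : PML k → ℕ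
  | .prop _ => 0
  | .not φ => φ.md
  | .and φ₁ φ₂ => max φ₁.md φ₂.md
  | .modal _ _ _ φs => 1 + Finset.univ.sup (fun i => (φs i).md)

def PML.deg {k : ℕ} : PML k → ℕ
  | .prop _ => 0
  | .not φ => φ.deg
  | .and φ₁ φ₂ => max φ₁.deg φ₂.deg
  | .modal _ _ ψ φs => max ψ.deg (Finset.univ.sup (fun i => (φs i).deg))

def PML.onlyTop {k : ℕ} : PML k → Prop
  | .prop _ => True
  | .not φ => φ.onlyTop
  | .and φ₁ φ₂ => φ₁.onlyTop ∧ φ₂.onlyTop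
  | .modal _ π _ φs => (∀ i, π i = Modality.top) ∧ (∀ i, (φs i).onlyTop)

def PML.onlyE {k : ℕ} : PML k → Prop
  | .prop _ => True
  | .not φ => φ.onlyE
  | .and φ₁ φ₂ => φ₁.onlyE ∧ φ₂.onlyE
  | .modal _ π _ φs => (∀ i, π i = Modality.ein ∨ π i = Modality.eout) ∧ (∀ i, (φs i).onlyE)

/-- Propositional formulas: no modal subformula at all. -/
def PML.NoModal {k : ℕ} : PML k → Prop
  | .prop _ => True
  | .not φ => φ.NoModal
  | .and φ₁ φ₂ => φ₁.NoModal ∧ φ₂.NoModal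
  | .modal _ _ _ _ => False

/-- Subformula relation. -/
inductive PML.Sub {k : ℕ} : PML k → PML k → Prop where
  | refl (φ : PML k) : PML.Sub φ φ
  | not {χ φ : PML k} : PML.Sub χ φ → PML.Sub χ (.not φ)
  | and_left {χ φ₁ φ₂ : PML k} : PML.Sub χ φ₁ → PML.Sub χ (.and φ₁ φ₂)
  | and_right {χ φ₁ φ₂ : PML k} : PML.Sub χ φ₂ → PML.Sub χ (.and φ₁ φ₂)
  | modal {χ : PML k} {m : ℕ} {π : Fin m → Modality} {ψ : PeanoFormula m}
      {φs : Fin m → PML k} (i : Fin m) :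
      PML.Sub χ (φs i) → PML.Sub χ (.modal m π ψ φs)

/-- Finite directed node-labelled graphs with `k` colours; labels in `{0,1}^k`
are represented by Boolean vectors. -/
structure Graph (k : ℕ) where
  n : ℕ
  E : Finset (Fin n × Fin n)
  L : Fin n → Fin k → Bool

def Graph.neighIn {k : ℕ} (G : Graph k) (v : Fin G.n) : Finset (Fin G.n) :=
  Finset.univ.filter (fun u => (u, v) ∈ G.E)

def Graph.neighOut {k : ℕ} (G : Graph k) (v : Fin G.n) : Finset (Fin G.n) :=
  Finset.univ.filter (fun u => (v, u) ∈ G.E)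

def Graph.Regular {k : ℕ} (G : Graph k) : Prop :=
  ∀ u v : Fin G.n,
    (G.neighIn u).card = (G.neighIn v).card ∧ (G.neighOut u).card = (G.neighOut v).card

/-- `v` is marked by colour `p`. -/
def Graph.MarkedBy {k : ℕ} (G : Graph k) (v : Fin G.n) (p : Fin k) : Prop :=
  ∀ u : Fin G.n, G.L u p = true ↔ u = v

/-- `v` is strongly marked by colour `p`: marked and `v ∈ neigh(v)`. -/
def Graph.StronglyMarkedBy {k : ℕ} (G : Graph k) (v : Fin G.n) (p : Fin k) : Prop :=
  G.MarkedBy v p ∧ (v, v) ∈ G.E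

def Graph.modSem {k : ℕ} (G : Graph k) (v : Fin G.n) : Modality → Finset (Fin G.n)
  | .id => {v}
  | .ein => G.neighIn v
  | .eout => G.neighOut v
  | .top => Finset.univ

/-- Satisfaction of PML formulas on pointed graphs. -/
def PML.sat {k : ℕ} (G : Graph k) : PML k → Fin G.n → Bool
  | .prop i, v => G.L v i
  | .not φ, v => ! PML.sat G φ v
  | .and φ₁ φ₂, v => PML.sat G φ₁ v && PML.sat G φ₂ v
  | .modal _ π ψ φs, v =>
      ψ.sat (fun i => ((G.modSem v (π i)).filter (fun u => PML.sat G (φs i) u = true)).card)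

/-- Feedforward neural networks with ReLU activations and rational weights. -/
inductive FNN : ℕ → ℕ → Type where
  | layer {din dout : ℕ} (w : Fin dout → Fin din → ℚ) (b : Fin dout → ℚ) : FNN din dout
  | comp {d₁ d₂ d₃ : ℕ} : FNN d₁ d₂ → FNN d₂ d₃ → FNN d₁ d₃

def FNN.eval : {din dout : ℕ} → FNN din dout → (Fin din → ℚ) → Fin dout → ℚ
  | _, _, .layer w b, x => fun j => max 0 (b j + ∑ i, w j i * x i)
  | _, _, .comp f g, x => g.eval (f.eval x)

/-- Aggregation functions on finite multisets of vectors. -/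
inductive Agg where
  | mean | sum | max
deriving DecidableEq

noncomputable def Agg.eval {d : ℕ} : Agg → Multiset (Fin d → ℚ) → Fin d → ℚ
  | .mean, s => fun i => (s.map (fun f => f i)).sum / (Multiset.card s : ℚ)
  | .sum, s => fun i => (s.map (fun f => f i)).sum
  | .max, s => fun i => ((s.map (fun f => f i)).toList).foldr Max.max 0

/-- One MPNN layer: a combination function (an FNN applied to the previous
state and the three aggregated messages) together with the choice of the two
local and the global aggregation functions. -/
structure MPNNLayer (din dout : ℕ) where
  comb : FNN (din + din + din + din) dout
  locIn : Agg
  locOut : Agg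
  glob : Agg

noncomputable def MPNNLayer.step {k din dout : ℕ} (l : MPNNLayer din dout) (G : Graph k)
    (x : Fin G.n → Fin din → ℚ) : Fin G.n → Fin dout → ℚ :=
  fun v => l.comb.eval
    (Fin.append (Fin.append (Fin.append (x v)
      (l.locIn.eval ((G.neighIn v).val.map x)))
      (l.locOut.eval ((G.neighOut v).val.map x)))
      (l.glob.eval ((Finset.univ : Finset (Fin G.n)).val.map x)))

/-- A message passing neural network: `L` layers with state dimensions
`dims 0, dims 1, …, dims L`. -/
structure MPNN where
  L : ℕ
  dims : ℕ → ℕ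
  layers : (i : ℕ) → MPNNLayer (dims i) (dims (i + 1))

/-- Initial state: the label of the node (padded with zeros if needed). -/
def Graph.init {k : ℕ} (G : Graph k) (d : ℕ) (v : Fin G.n) : Fin d → ℚ :=
  fun j => if h : (j : ℕ) < k then (if G.L v ⟨j, h⟩ then 1 else 0) else 0

/-- The state `x_v^{(i)}` computed by `M` on `G`. -/
noncomputable def MPNN.state {k : ℕ} (M : MPNN) (G : Graph k) : (i : ℕ) → Fin G.n → Fin (M.dims i) → ℚ
  | 0 => fun v => G.init (M.dims 0) v
  | i + 1 => (M.layers i).step G (M.state G i)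

/-- Last coordinate of a vector. -/
def lastVal {d : ℕ} (x : Fin d → ℚ) : ℚ :=
  if h : 0 < d then x ⟨d - 1, Nat.sub_lt h Nat.one_pos⟩ else 0

/-- The output `M(G,v)_⊥`: the last coordinate of the final state. -/
noncomputable def MPNN.out {k : ℕ} (M : MPNN) (G : Graph k) (v : Fin G.n) : ℚ :=
  lastVal (M.state G M.L v)

/-- All aggregations of `M` belong to the set `A`. -/
def MPNN.UsesAggs (M : MPNN) (A : Set Agg) : Prop :=
  ∀ i < M.L, (M.layers i).locIn ∈ A ∧ (M.layers i).locOut ∈ A ∧ (M.layers i).glob ∈ A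

/-- `M` belongs to the class `M_mean`. -/
def MPNN.IsMean (M : MPNN) : Prop := M.UsesAggs {Agg.mean}

/-- `M` recognises `φ` over the class `Cls` with certainty `c(|V|)`. -/
def Recognises {k : ℕ} (M : MPNN) (φ : PML k)
    (Cls : (G : Graph k) → Fin G.n → Prop) (c : ℕ → ℚ) : Prop :=
  ∀ (G : Graph k) (v : Fin G.n), Cls G v →
    (PML.sat G φ v = true → M.out G v = c G.n) ∧
    (PML.sat G φ v = false → M.out G v = 0)

end PMLMPNN
namespace PMLMPNN

/-- Features: node-valued functions on graphs. -/
abbrev Feature (k : ℕ) := (G : Graph k) → Fin G.n → ℚ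

/-- Mean layer with given combination. -/
def meanL {d d' : ℕ} (c : FNN (d + d + d + d) d') : MPNNLayer d d' :=
  ⟨c, .mean, .mean, .mean⟩

/-- Sequences of mean layers. -/
inductive Net : ℕ → ℕ → ℕ → Type where
  | nil {d : ℕ} : Net d d 0
  | cons {d d1 d2 t : ℕ} : FNN (d + d + d + d) d1 → Net d1 d2 t → Net d d2 (t + 1)

def Net.snoc : {d d1 d2 t : ℕ} → Net d d1 t → FNN (d1 + d1 + d1 + d1) d2 → Net d d2 (t + 1)
  | _, _, _, _, .nil, c => .cons c .nil
  | _, _, _, _, .cons a n, c => .cons a (n.snoc c)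

noncomputable def Net.eval {k : ℕ} (G : Graph k) :
    {d d1 t : ℕ} → Net d d1 t → (Fin G.n → Fin d → ℚ) → Fin G.n → Fin d1 → ℚ
  | _, _, _, .nil, x => x
  | _, _, _, .cons a n, x => n.eval G ((meanL a).step G x)

theorem Net.eval_snoc {k : ℕ} (G : Graph k) {d d1 d2 t : ℕ} (n : Net d d1 t)
    (c : FNN (d1 + d1 + d1 + d1) d2) (x : Fin G.n → Fin d → ℚ) :
    (n.snoc c).eval G x = (meanL c).step G (n.eval G x) := by
  induction n with
  | nil => rfl
  | cons a n ih => simp only [Net.snoc, Net.eval]; exact ih _ _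

noncomputable def stateFrom {k : ℕ} (M : MPNN) (G : Graph k) (x : Fin G.n → Fin (M.dims 0) → ℚ) :
    (i : ℕ) → Fin G.n → Fin (M.dims i) → ℚ
  | 0 => x
  | i + 1 => (M.layers i).step G (stateFrom M G x i)

theorem state_eq {k : ℕ} (M : MPNN) (G : Graph k) (i : ℕ) :
    M.state G i = stateFrom M G (fun v => G.init (M.dims 0) v) i := by
  induction i with
  | zero => rfl
  | succ i ih => simp only [MPNN.state, stateFrom, ih]

def prepDims (d : ℕ) (f : ℕ → ℕ) : ℕ → ℕ
  | 0 => d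
  | i + 1 => f i

def prepLayers (d : ℕ) (M : MPNN) (l : MPNNLayer d (M.dims 0)) :
    (i : ℕ) → MPNNLayer (prepDims d M.dims i) (prepDims d M.dims (i + 1))
  | 0 => l
  | i + 1 => M.layers i

def prep {d : ℕ} (M : MPNN) (l : MPNNLayer d (M.dims 0)) : MPNN :=
  ⟨M.L + 1, prepDims d M.dims, prepLayers d M l⟩

theorem prep_state {k d : ℕ} (M : MPNN) (l : MPNNLayer d (M.dims 0)) (G : Graph k)
    (x : Fin G.n → Fin d → ℚ) (i : ℕ) :
    stateFrom (prep M l) G x (i + 1) = stateFrom M G (l.step G x) i := by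
  induction i with
  | zero => rfl
  | succ i ih =>
    change (M.layers i).step G (stateFrom (prep M l) G x (i + 1)) = (M.layers i).step G _
    exact congrArg _ ih

theorem net_to_mpnn {d d' t : ℕ} (net : Net d d' t) :
    ∃ M : MPNN, M.L = t ∧ M.IsMean ∧ ∃ h : M.dims 0 = d, ∀ (k : ℕ) (G : Graph k)
      (x : Fin G.n → Fin d → ℚ) (v : Fin G.n),
      lastVal (stateFrom M G (fun v j => x v (Fin.cast h j)) M.L v) = lastVal (net.eval G x v) := by
  induction net with
  | @nil d =>
    refine ⟨⟨0, fun _ => d, fun _ => meanL (.layer 0 0)⟩, rfl, ?_, rfl, ?_⟩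
    · intro i hi; exact absurd hi (Nat.not_lt_zero _)
    · intro k G x v; rfl
  | cons a n ih =>
    obtain ⟨M, hL, hM, h0, hs⟩ := ih
    subst h0
    refine ⟨prep M (meanL a), by simp [prep, hL], ?_, rfl, ?_⟩
    · intro i hi
      cases i with
      | zero => exact ⟨rfl, rfl, rfl⟩
      | succ i => exact hM i (Nat.lt_of_succ_lt_succ hi)
    · intro k G x v
      have := hs k G ((meanL a).step G x) v
      rw [Net.eval, ← this]
      change lastVal (stateFrom (prep M (meanL a)) G x (M.L + 1) v) = _
      rw [prep_state]; rfl

/-- Mean over a modality. -/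
noncomputable def agg {k : ℕ} (π : Modality) (f : Feature k) : Feature k :=
  fun G v => (∑ u ∈ G.modSem v π, f G u) / ((G.modSem v π).card : ℚ)

/-- Label feature. -/
def lab {k : ℕ} (i : Fin k) : Feature k := fun G v => if G.L v i then 1 else 0

def labels (k : ℕ) : Set (Feature k) := Set.range lab

/-- All features of `T` are computed by a mean network with `t+1` layers. -/
def R {k : ℕ} (t : ℕ) (T : Set (Feature k)) : Prop :=
  ∃ (d m : ℕ) (net : Net k d t) (c : FNN (d + d + d + d) m), ∀ h ∈ T, ∃ j : Fin m,
    ∀ (G : Graph k) (v : Fin G.n),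
      (meanL c).step G (net.eval G (fun v => G.init k v)) v j = h G v

theorem R.mono {k t : ℕ} {S T : Set (Feature k)} (h : R t T) (hS : S ⊆ T) : R t S := by
  obtain ⟨d, m, net, c, hc⟩ := h
  exact ⟨d, m, net, c, fun h hh => hc h (hS hh)⟩

theorem FNN.eval_nonneg {d d' : ℕ} (c : FNN d d') (x : Fin d → ℚ) (j : Fin d') :
    0 ≤ c.eval x j := by
  induction c with
  | layer w b => exact le_max_left _ _
  | comp f g _ ihg => exact ihg _ _

/-- Identity layer. -/
def idF (d : ℕ) : FNN d d := .layer (fun i j => if i = j then 1 else 0) 0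

theorem idF_eval {d : ℕ} (x : Fin d → ℚ) (j : Fin d) (h : 0 ≤ x j) : (idF d).eval x j = x j := by
  simp [idF, FNN.eval, h]

theorem step_coord {k d : ℕ} (π : Modality) (j : Fin d) :
    ∃ i : Fin (d + d + d + d), ∀ (G : Graph k) (x : Fin G.n → Fin d → ℚ), (∀ v j, 0 ≤ x v j) →
      ∀ v, (meanL (idF (d + d + d + d))).step G x v i =
        (∑ u ∈ G.modSem v π, x u j) / ((G.modSem v π).card : ℚ) := by
  have hn : ∀ (G : Graph k) (x : Fin G.n → Fin d → ℚ), (∀ v j, 0 ≤ x v j) →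
      ∀ s : Finset (Fin G.n), 0 ≤ (∑ u ∈ s, x u j) / (s.card : ℚ) := by
    intro G x hx s
    exact div_nonneg (Finset.sum_nonneg fun u _ => hx u j) (Nat.cast_nonneg _)
  have key : ∀ (G : Graph k) (x : Fin G.n → Fin d → ℚ) (s : Finset (Fin G.n)),
      Agg.mean.eval (s.val.map x) j = (∑ u ∈ s, x u j) / (s.card : ℚ) := by
    intro G x s
    simp only [Agg.eval, Multiset.map_map, Multiset.card_map]
    rfl
  cases π with
  | id =>
    refine ⟨Fin.castAdd d (Fin.castAdd d (Fin.castAdd d j)), fun G x hx v => ?_⟩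
    simp only [MPNNLayer.step, meanL]
    rw [idF_eval] <;> simp [Fin.append_left, Graph.modSem, hx]
  | ein =>
    refine ⟨Fin.castAdd d (Fin.castAdd d (Fin.natAdd d j)), fun G x hx v => ?_⟩
    simp only [MPNNLayer.step, meanL]
    rw [idF_eval] <;> simp only [Fin.append_left, Fin.append_right, Graph.modSem, key, hn G x hx]
  | eout =>
    refine ⟨Fin.castAdd d (Fin.natAdd (d + d) j), fun G x hx v => ?_⟩
    simp only [MPNNLayer.step, meanL]
    rw [idF_eval] <;> simp only [Fin.append_left, Fin.append_right, Graph.modSem, key, hn G x hx]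
  | top =>
    refine ⟨Fin.natAdd (d + d + d) j, fun G x hx v => ?_⟩
    simp only [MPNNLayer.step, meanL]
    rw [idF_eval] <;> simp only [Fin.append_right, Graph.modSem, key, hn G x hx]

theorem agg_id {k : ℕ} (f : Feature k) : agg .id f = f := by
  funext G v; simp [agg, Graph.modSem]

theorem R_base (k : ℕ) : R 0 (labels k) := by
  refine ⟨k, _, .nil, idF _, ?_⟩
  rintro _ ⟨i, rfl⟩
  obtain ⟨j, hj⟩ := step_coord (k := k) .id i
  refine ⟨j, fun G v => ?_⟩
  rw [Net.eval, hj]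
  · rw [Graph.modSem, Finset.sum_singleton, Finset.card_singleton]
    simp [Graph.init, lab]
  · intro v j; simp only [Graph.init]; split_ifs <;> norm_num

theorem R_step {k t : ℕ} {T : Set (Feature k)} (h : R t T) :
    R (t + 1) {f | ∃ π, ∃ g ∈ T, f = agg π g} := by
  obtain ⟨d, m, net, c, hc⟩ := h
  refine ⟨m, _, net.snoc c, idF _, ?_⟩
  rintro _ ⟨π, g, hg, rfl⟩
  obtain ⟨j, hj⟩ := hc g hg
  obtain ⟨i, hi⟩ := step_coord (k := k) π j
  refine ⟨i, fun G v => ?_⟩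
  rw [Net.eval_snoc, hi]
  · simp only [hj, agg]
  · intro v j; exact FNN.eval_nonneg _ _ _

theorem R_insert {k t : ℕ} {T : Set (Feature k)} (h : R t T) {q : ℕ} (g : Fin q → Feature k)
    (hg : ∀ i, g i ∈ T) (w : Fin q → ℚ) (b : ℚ) :
    R t (insert (fun G v => max 0 (b + ∑ i, w i * g i G v)) T) := by
  obtain ⟨d, m, net, c, hc⟩ := h
  choose J hJ using fun i => hc (g i) (hg i)
  let L : FNN m (m + 1) := .layer
    (Fin.snoc (α := fun _ => Fin m → ℚ) (fun j j' => if j = j' then 1 else 0)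
      (fun j => ∑ i, if J i = j then w i else 0)) (Fin.snoc (α := fun _ => ℚ) (fun _ => 0) b)
  refine ⟨d, m + 1, net, c.comp L, ?_⟩
  have hstep : ∀ (G : Graph k) (v : Fin G.n),
      (meanL (c.comp L)).step G (net.eval G (fun v => G.init k v)) v =
        L.eval ((meanL c).step G (net.eval G (fun v => G.init k v)) v) := fun G v => rfl
  rintro f (rfl | hf)
  · refine ⟨Fin.last m, fun G v => ?_⟩
    rw [hstep]
    simp only [L, FNN.eval, Fin.snoc_last]
    congr 2
    simp_rw [Finset.sum_mul]
    rw [Finset.sum_comm]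
    refine Finset.sum_congr rfl fun i _ => ?_
    simp [hJ]
  · obtain ⟨j, hj⟩ := hc f hf
    refine ⟨j.castSucc, fun G v => ?_⟩
    rw [hstep, ← hj]
    simp only [L, FNN.eval, Fin.snoc_castSucc]
    have : 0 ≤ (meanL c).step G (net.eval G (fun v => G.init k v)) v j := FNN.eval_nonneg _ _ _
    simp [this]

theorem R_final {k t : ℕ} {T : Set (Feature k)} (h : R t T) (f : Feature k) (hf : f ∈ T) :
    ∃ M : MPNN, M.L = t + 1 ∧ M.IsMean ∧ M.dims 0 = k ∧
      ∀ (G : Graph k) (v : Fin G.n), M.out G v = f G v := by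
  obtain ⟨d, m, net, c, hc⟩ := h
  obtain ⟨j, hj⟩ := hc f hf
  let L : FNN m 1 := .layer (fun _ j' => if j = j' then 1 else 0) 0
  obtain ⟨M, hL, hM, h0, hs⟩ := net_to_mpnn (net.snoc (c.comp L))
  refine ⟨M, hL, hM, h0, fun G v => ?_⟩
  have := hs k G (fun v => G.init k v) v
  rw [MPNN.out, state_eq]
  have e : (fun v j => G.init k v (Fin.cast h0 j)) = fun v => G.init (M.dims 0) v := by
    funext v j; simp [Graph.init]
  rw [e] at this
  rw [this, Net.eval_snoc]
  have hstep : (meanL (c.comp L)).step G (net.eval G (fun v => G.init k v)) v =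
        L.eval ((meanL c).step G (net.eval G (fun v => G.init k v)) v) := rfl
  rw [hstep, ← hj]
  have : 0 ≤ (meanL c).step G (net.eval G (fun v => G.init k v)) v j := FNN.eval_nonneg _ _ _
  simp [lastVal, L, FNN.eval, this]

/-- `h` can be added to any realisable set containing `T`. -/
def Ext {k : ℕ} (t : ℕ) (T : Set (Feature k)) (h : Feature k) : Prop :=
  ∀ T', T ⊆ T' → R t T' → R t (insert h T')

theorem Ext.mem {k t : ℕ} {T : Set (Feature k)} {h : Feature k} (hh : h ∈ T) : Ext t T h := by
  intro T' hT hR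
  rwa [Set.insert_eq_of_mem (hT hh)]

theorem Ext.mono {k t : ℕ} {S T : Set (Feature k)} {h : Feature k} (hh : Ext t S h) (hS : S ⊆ T) :
    Ext t T h := fun T' hT hR => hh T' (hS.trans hT) hR

theorem Ext.list {k t : ℕ} {T : Set (Feature k)} {ι : Type} (g : ι → Feature k) (l : List ι)
    (hg : ∀ i ∈ l, Ext t T (g i)) (hR : R t T) : R t (T ∪ {f | ∃ i ∈ l, f = g i}) := by
  induction l with
  | nil => exact hR.mono (by simp)
  | cons a l ih =>
    have h1 := ih fun i hi => hg i (by simp [hi])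
    refine (hg a (by simp) _ Set.subset_union_left h1).mono ?_
    rintro f (hf | ⟨i, hi, rfl⟩)
    · exact Or.inr (Or.inl hf)
    · rcases List.mem_cons.1 hi with rfl | hi
      · exact Or.inl rfl
      · exact Or.inr (Or.inr ⟨i, hi, rfl⟩)

theorem Ext.relu {k t : ℕ} {T : Set (Feature k)} {q : ℕ} (g : Fin q → Feature k)
    (hg : ∀ i, Ext t T (g i)) (w : Fin q → ℚ) (b : ℚ) :
    Ext t T (fun G v => max 0 (b + ∑ i, w i * g i G v)) := by
  intro T' hT hR
  have h1 := Ext.list g (List.finRange q) (fun i _ => (hg i).mono hT) hR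
  refine (R_insert h1 g (fun i => Or.inr ⟨i, by simp, rfl⟩) w b).mono ?_
  exact Set.insert_subset_insert Set.subset_union_left

theorem Ext.relu3 {k t : ℕ} {T : Set (Feature k)} {f g h : Feature k} (hf : Ext t T f)
    (hg : Ext t T g) (hh : Ext t T h) (a b c e : ℚ) :
    Ext t T (fun G v => max 0 (e + (a * f G v + b * g G v + c * h G v))) := by
  have := Ext.relu ![f, g, h] (T := T) (t := t) (by
    intro i; fin_cases i <;> assumption) ![a, b, c] e
  have e : (fun (G : Graph k) (v : Fin G.n) =>
      max 0 (e + ∑ i, (![a, b, c] : Fin 3 → ℚ) i * (![f, g, h] : Fin 3 → Feature k) i G v)) =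
      fun G v => max 0 (e + (a * f G v + b * g G v + c * h G v)) := by
    funext G v
    rw [Fin.sum_univ_three]
    rfl
  rwa [e] at this

/-- Indicator feature of a formula. -/
def ind {k : ℕ} (χ : PML k) : Feature k := fun G v => if PML.sat G χ v then 1 else 0

theorem ext_ind {k t : ℕ} (χ : PML k) (hχ : χ.md = 0) : Ext t (labels k) (ind χ) := by
  induction χ with
  | prop i => exact Ext.mem ⟨i, rfl⟩
  | not φ ih =>
    have h := ih hχ
    convert Ext.relu3 h h h (-1) 0 0 1 using 3
    simp only [ind, PML.sat]
    rename_i G v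
    by_cases hb : PML.sat G φ v = true <;> simp [hb]
  | and φ₁ φ₂ ih₁ ih₂ =>
    simp only [PML.md, Nat.max_eq_zero_iff] at hχ
    have h1 := ih₁ hχ.1
    have h2 := ih₂ hχ.2
    convert Ext.relu3 h1 h2 h2 1 1 0 (-1) using 3
    simp only [ind, PML.sat]
    rename_i G v
    by_cases hb : PML.sat G φ₁ v = true <;> by_cases hb' : PML.sat G φ₂ v = true <;> simp [hb, hb']
  | modal m π ψ φs ih => simp [PML.md] at hχ

abbrev Letter (k : ℕ) := Modality × PML k

/-- The feature attached to a word (parameter `p`: the marking colour). -/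
noncomputable def Y {k : ℕ} (p : Fin k) (X : Feature k) : Feature k :=
  fun G v => max 0 (-1 + (1 * X G v + 1 * lab p G v + 0 * X G v))

noncomputable def Z {k : ℕ} (p : Fin k) (a : Letter k) (X : Feature k) : Feature k :=
  fun G v => max 0 (-1 + (1 * agg .top (Y p X) G v + 1 * ind a.2 G v + 0 * ind a.2 G v))

noncomputable def X {k : ℕ} (p : Fin k) : List (Letter k) → Feature k
  | [] => fun _ _ => 1
  | a :: l => agg a.1 (Z p a (X p l))

/-- Words all of length `D`, all whose letters carry modal-free formulas. -/
def Good {k : ℕ} (D : ℕ) (W : List (List (Letter k))) : Prop :=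
  ∀ w ∈ W, w.length = D ∧ ∀ a ∈ w, a.2.md = 0

theorem R_words {k : ℕ} (p : Fin k) (D : ℕ) (W : List (List (Letter k))) (hW : Good D W) (r : ℕ)
    (hr : r ≤ D) :
    R (2 * r) (labels k ∪ {f | ∃ w ∈ W, f = X p (w.drop (D - r))}) := by
  induction r with
  | zero =>
    refine Ext.list (fun w => X p (w.drop (D - 0))) W ?_ (R_base k)
    intro w hw
    have : w.drop (D - 0) = [] := by simp [(hW w hw).1]
    simp only [this, X]
    have := Ext.relu (k := k) (t := 0) (T := labels k) (q := 0) Fin.elim0 (fun i => i.elim0) Fin.elim0 1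
    simpa using this
  | succ r ih =>
    have h0 := ih (by omega)
    have h1 := Ext.list (fun w : List (Letter k) => Y p (X p (w.drop (D - r)))) W (by
      intro w hw
      have hX : Ext (2 * r) (labels k ∪ {f | ∃ w ∈ W, f = X p (w.drop (D - r))})
        (X p (w.drop (D - r))) := Ext.mem (Or.inr ⟨w, hw, rfl⟩)
      exact Ext.relu3 hX (Ext.mem (Or.inl ⟨p, rfl⟩)) hX 1 1 0 (-1)) h0
    have h2 := (R_step h1).mono
      (S := labels k ∪ {f | ∃ w ∈ W, f = agg .top (Y p (X p (w.drop (D - r))))}) (by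
      rintro f (hf | ⟨w, hw, rfl⟩)
      · exact ⟨.id, f, Or.inl (Or.inl hf), (agg_id f).symm⟩
      · exact ⟨.top, _, Or.inr ⟨w, hw, rfl⟩, rfl⟩)
    have hdrop : ∀ w ∈ W, ∃ a, w.drop (D - (r + 1)) = a :: w.drop (D - r) ∧ a.2.md = 0 := by
      intro w hw
      have hl := (hW w hw).1
      have hlt : D - (r + 1) < w.length := by omega
      refine ⟨w[D - (r + 1)], ?_, (hW w hw).2 _ (List.getElem_mem _)⟩
      rw [List.drop_eq_getElem_cons hlt]
      congr 2; omega
    haveI : Nonempty (Letter k) := ⟨(.top, .prop p)⟩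
    choose! A hA hAm using hdrop
    have h3 := Ext.list (fun w : List (Letter k) => Z p (A w) (X p (w.drop (D - r)))) W (by
      intro w hw
      have hi := (ext_ind (t := 2 * r + 1) (A w).2 (hAm w hw)).mono (T :=
        labels k ∪ {f | ∃ w ∈ W, f = agg .top (Y p (X p (w.drop (D - r))))}) Set.subset_union_left
      exact Ext.relu3 (Ext.mem (Or.inr ⟨w, hw, rfl⟩)) hi hi 1 1 0 (-1)) h2
    refine (R_step h3).mono ?_
    rintro f (hf | ⟨w, hw, rfl⟩)
    · exact ⟨.id, f, Or.inl (Or.inl hf), (agg_id f).symm⟩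
    · refine ⟨(A w).1, _, Or.inr ⟨w, hw, rfl⟩, ?_⟩
      rw [hA w hw, X]

theorem agg_nonneg {k : ℕ} (π : Modality) (f : Feature k) (G : Graph k) (hf : ∀ u, 0 ≤ f G u)
    (v : Fin G.n) : 0 ≤ agg π f G v :=
  div_nonneg (Finset.sum_nonneg fun u _ => hf u) (Nat.cast_nonneg _)

theorem agg_le_one {k : ℕ} (π : Modality) (f : Feature k) (G : Graph k) (hf : ∀ u, f G u ≤ 1)
    (v : Fin G.n) : agg π f G v ≤ 1 := by
  apply div_le_one_of_le₀ _ (Nat.cast_nonneg _)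
  calc _ ≤ ∑ u ∈ G.modSem v π, (1 : ℚ) := Finset.sum_le_sum fun u _ => hf u
    _ = _ := by simp

theorem X_bd {k : ℕ} (p : Fin k) (l : List (Letter k)) (G : Graph k) (v : Fin G.n) :
    0 ≤ X p l G v ∧ X p l G v ≤ 1 := by
  induction l generalizing v with
  | nil => simp [X]
  | cons a l ih =>
    rw [X]
    refine ⟨agg_nonneg _ _ _ (fun u => le_max_left _ _) _, agg_le_one _ _ _ (fun u => ?_) _⟩
    refine max_le zero_le_one ?_
    have h1 : agg .top (Y p (X p l)) G u ≤ 1 := by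
      refine agg_le_one _ _ _ (fun u => max_le zero_le_one ?_) _
      have h2 : lab p G u ≤ 1 := by unfold lab; split_ifs <;> norm_num
      have := (ih u).2
      linarith
    have h2 : ind a.2 G u ≤ 1 := by unfold ind; split_ifs <;> norm_num
    linarith

/-- The normalised count of a letter. -/
noncomputable def lv {k : ℕ} (G : Graph k) (v : Fin G.n) (a : Letter k) : ℚ :=
  (((G.modSem v a.1).filter (fun u => PML.sat G a.2 u = true)).card : ℚ) / ((G.modSem v a.1).card : ℚ)

theorem X_val {k : ℕ} (p : Fin k) (l : List (Letter k)) (G : Graph k) (v : Fin G.n)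
    (hv : G.MarkedBy v p) : X p l G v = (l.map (lv G v)).prod / (G.n : ℚ) ^ l.length := by
  induction l with
  | nil => simp [X]
  | cons a l ih =>
    have hY : ∀ u, Y p (X p l) G u = if u = v then X p l G v else 0 := by
      intro u
      have hb := X_bd p l G u
      by_cases h : u = v
      · subst h
        have : G.L u p = true := (hv u).2 rfl
        simp [Y, lab, this, hb.1]
      · have : G.L u p = false := by
          rw [← Bool.not_eq_true]; exact fun h' => h ((hv u).1 h')
        simp [Y, lab, this, h, hb.2]
    have hB : ∀ u, agg .top (Y p (X p l)) G u = X p l G v / G.n := by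
      intro u
      simp [agg, hY, Graph.modSem]
    have hBb : 0 ≤ X p l G v / G.n ∧ X p l G v / G.n ≤ 1 := by
      rw [← hB v]
      refine ⟨agg_nonneg _ _ _ (fun u => le_max_left _ _) _, agg_le_one _ _ _ (fun u => ?_) _⟩
      rw [hY]; split_ifs
      · exact (X_bd p l G v).2
      · exact zero_le_one
    have hZ : ∀ u, Z p a (X p l) G u = if PML.sat G a.2 u = true then X p l G v / G.n else 0 := by
      intro u
      simp only [Z, hB, ind]
      split_ifs
      · simp [hBb.1]
      · simp [hBb.2]
    rw [X, agg]
    simp only [hZ]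
    rw [← Finset.sum_filter, Finset.sum_const, nsmul_eq_mul, ih]
    simp only [List.map_cons, List.prod_cons, List.length_cons, lv, pow_succ]
    field_simp

theorem deg_eq {k : ℕ} (G : Graph k) (v : Fin G.n) (h : G.Regular) :
    (G.neighIn v).card = (G.neighOut v).card := by
  have h1 : ∑ u, (G.neighIn u).card = ∑ u, (G.neighOut u).card := by
    simp only [Graph.neighIn, Graph.neighOut, Finset.card_filter]
    rw [Finset.sum_comm]
  rw [Finset.sum_congr rfl fun u _ => (h u v).1, Finset.sum_congr rfl fun u _ => (h u v).2] at h1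
  simp only [Finset.sum_const, smul_eq_mul, Finset.card_univ, Fintype.card_fin] at h1
  exact Nat.eq_of_mul_eq_mul_left (Fin.pos v) h1

/-- The semantic specification: `h` takes the value `1/n^(2D)` or `0` according to `s`. -/
def Spec {k : ℕ} (p : Fin k) (D : ℕ) (s : (G : Graph k) → Fin G.n → Bool) (h : Feature k) : Prop :=
  ∀ (G : Graph k) (v : Fin G.n), G.Regular → G.StronglyMarkedBy v p →
    h G v = if s G v then 1 / (G.n : ℚ) ^ (2 * D) else 0

def Claim {k : ℕ} (p : Fin k) (D : ℕ) (s : (G : Graph k) → Fin G.n → Bool) : Prop :=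
  ∃ W, Good D W ∧ ∃ h, Spec p D s h ∧ ∀ t T, labels k ⊆ T → (∀ w ∈ W, X p w ∈ T) → Ext t T h

/-- The word computing the certainty. -/
def dW {k : ℕ} (p : Fin k) (D : ℕ) : List (Letter k) := List.replicate D (.top, .prop p)

theorem dW_good {k : ℕ} (p : Fin k) (D : ℕ) : Good D [dW p D] := by
  intro w hw
  rw [List.mem_singleton] at hw
  subst hw
  refine ⟨by simp [dW], fun a ha => ?_⟩
  rw [List.eq_of_mem_replicate ha]; rfl

theorem Good.append {k D : ℕ} {W W' : List (List (Letter k))} (h : Good D W) (h' : Good D W') :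
    Good D (W ++ W') := by
  intro w hw
  rcases List.mem_append.1 hw with hw | hw
  · exact h w hw
  · exact h' w hw

theorem filter_marked {k : ℕ} (p : Fin k) (G : Graph k) (v : Fin G.n) (hv : G.MarkedBy v p)
    (s : Finset (Fin G.n)) (hs : v ∈ s) :
    s.filter (fun u => PML.sat G (.prop p) u = true) = {v} := by
  ext u
  rw [Finset.mem_filter, Finset.mem_singleton, PML.sat, hv u]
  constructor
  · exact fun h => h.2
  · rintro rfl; exact ⟨hs, rfl⟩

theorem dW_val {k : ℕ} (p : Fin k) (D : ℕ) (G : Graph k) (v : Fin G.n) (hv : G.MarkedBy v p) :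
    X p (dW p D) G v = 1 / (G.n : ℚ) ^ (2 * D) := by
  rw [X_val p _ G v hv]
  have : lv G v (.top, .prop p) = 1 / G.n := by
    rw [lv]
    simp only [filter_marked p G v hv (G.modSem v .top) (by simp [Graph.modSem])]
    simp [Graph.modSem]
  rw [dW, List.map_replicate, List.prod_replicate, List.length_replicate, this, div_pow, one_pow,
    div_div, ← pow_add, two_mul]

theorem d_le {k : ℕ} (D : ℕ) (G : Graph k) : 1 / (G.n : ℚ) ^ (2 * D) ≤ 1 := by
  rcases Nat.eq_zero_or_pos G.n with h | h
  · rw [h]; rcases Nat.eq_zero_or_pos D with rfl | h' 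
    · simp
    · rw [Nat.cast_zero, zero_pow (by omega)]; simp
  · have : (1 : ℚ) ≤ G.n := by exact_mod_cast h
    exact div_le_one_of_le₀ (one_le_pow₀ this) (by positivity)

theorem claim_not {k : ℕ} {p : Fin k} {D : ℕ} {s : (G : Graph k) → Fin G.n → Bool}
    (h : Claim p D s) : Claim p D (fun G v => ! s G v) := by
  obtain ⟨W, hW, f, hf, hE⟩ := h
  refine ⟨W ++ [dW p D], hW.append (dW_good p D),
    fun G v => max 0 (0 + (1 * X p (dW p D) G v + (-1) * f G v + 0 * f G v)), ?_, ?_⟩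
  · intro G v hr hv
    have := hf G v hr hv
    have hd : 0 ≤ X p (dW p D) G v := (X_bd p _ G v).1
    simp only [dW_val p D G v hv.1] at hd ⊢
    rw [this]
    by_cases hb : s G v = true
    · simp [hb]
    · simpa [hb] using hd
  · intro t T hl hT
    have h1 := hE t T hl fun w hw => hT w (by simp [hw])
    exact Ext.relu3 (Ext.mem (hT _ (by simp))) h1 h1 1 (-1) 0 0

theorem claim_and {k : ℕ} {p : Fin k} {D : ℕ} {s s' : (G : Graph k) → Fin G.n → Bool}
    (h : Claim p D s) (h' : Claim p D s') : Claim p D (fun G v => s G v && s' G v) := by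
  obtain ⟨W, hW, f, hf, hE⟩ := h
  obtain ⟨W', hW', f', hf', hE'⟩ := h'
  refine ⟨(W ++ W') ++ [dW p D], (hW.append hW').append (dW_good p D),
    fun G v => max 0 (0 + (1 * f G v + 1 * f' G v + (-1) * X p (dW p D) G v)), ?_, ?_⟩
  · intro G v hr hv
    have h1 := hf G v hr hv
    have h2 := hf' G v hr hv
    have hd : 0 ≤ X p (dW p D) G v := (X_bd p _ G v).1
    simp only [dW_val p D G v hv.1] at hd ⊢
    rw [h1, h2]
    by_cases hb : s G v = true <;> by_cases hb' : s' G v = true <;>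
      simp only [hb, hb', Bool.and_true, Bool.and_false, Bool.true_and, Bool.false_and, if_true,
        Bool.false_eq_true, if_false, Bool.not_eq_true] <;>
      first | (apply max_eq_left; linarith) | (rw [max_eq_right] <;> linarith)
  · intro t T hl hT
    have h1 := hE t T hl fun w hw => hT w (by simp [hw])
    have h2 := hE' t T hl fun w hw => hT w (by simp [hw])
    exact Ext.relu3 h1 h2 (Ext.mem (hT _ (by simp))) 1 1 (-1) 0

theorem claim_prop {k : ℕ} (p : Fin k) (D : ℕ) (i : Fin k) :
    Claim p D (fun G v => PML.sat G (.prop i) v) := by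
  refine ⟨[dW p D], dW_good p D,
    fun G v => max 0 (-1 + (1 * X p (dW p D) G v + 1 * lab i G v + 0 * lab i G v)), ?_, ?_⟩
  · intro G v hr hv
    have hd : 0 ≤ X p (dW p D) G v := (X_bd p _ G v).1
    have hd' := d_le D G
    simp only [dW_val p D G v hv.1] at hd ⊢
    simp only [lab, PML.sat]
    by_cases hb : G.L v i = true
    · simpa [hb] using hd
    · simpa [hb] using hd'
  · intro t T hl hT
    have h1 : Ext t T (lab i) := Ext.mem (hl ⟨i, rfl⟩)
    exact Ext.relu3 (Ext.mem (hT _ (by simp))) h1 h1 1 1 0 (-1)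

/-- The padded word of a monomial. -/
def mW {k m : ℕ} (p : Fin k) (D : ℕ) (π : Fin m → Modality) (φs : Fin m → PML k)
    (l : List (Fin m)) : List (Letter k) :=
  l.map (fun j => (π j, φs j)) ++ List.replicate (D - l.length) (.ein, .prop p)

theorem mW_good {k m : ℕ} (p : Fin k) (D : ℕ) (π : Fin m → Modality) (φs : Fin m → PML k)
    (hm : ∀ i, (φs i).md = 0) (l : List (Fin m)) (hl : l.length ≤ D) : Good D [mW p D π φs l] := by
  intro w hw
  rw [List.mem_singleton] at hw
  subst hw
  refine ⟨by simp [mW, hl], fun a ha => ?_⟩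
  rcases List.mem_append.1 ha with ha | ha
  · obtain ⟨j, _, rfl⟩ := List.mem_map.1 ha
    exact hm j
  · rw [List.eq_of_mem_replicate ha]; rfl

theorem mW_val {k m : ℕ} (p : Fin k) (D : ℕ) (π : Fin m → Modality) (φs : Fin m → PML k)
    (hπ : ∀ i, π i = Modality.ein ∨ π i = Modality.eout)
    (l : List (Fin m)) (hl : l.length ≤ D) (G : Graph k) (v : Fin G.n) (hr : G.Regular)
    (hv : G.StronglyMarkedBy v p) :
    X p (mW p D π φs l) G v =
      (monValZ (fun i => ((G.modSem v (π i)).filter (fun u => PML.sat G (φs i) u = true)).card) l : ℚ)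
        / (((G.neighIn v).card : ℚ) * G.n) ^ D := by
  rw [X_val p _ G v hv.1]
  have hlen : (mW p D π φs l).length = D := by simp [mW, hl]
  have h1 : lv G v (.ein, .prop p) = 1 / ((G.neighIn v).card : ℚ) := by
    rw [lv]
    simp only [filter_marked p G v hv.1 (G.modSem v .ein)
      (by simp [Graph.modSem, Graph.neighIn, hv.2])]
    simp [Graph.modSem]
  have h2 : ∀ j, lv G v (π j, φs j) =
      (((G.modSem v (π j)).filter (fun u => PML.sat G (φs j) u = true)).card : ℚ)
        / ((G.neighIn v).card : ℚ) := by
    intro j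
    rw [lv]
    rcases hπ j with h | h
    · simp only [h, Graph.modSem]
    · simp only [h, Graph.modSem, deg_eq G v hr]
  have h3 : ∀ l : List (Fin m), ((l.map (fun j => (π j, φs j))).map (lv G v)).prod =
      (monValZ (fun i => ((G.modSem v (π i)).filter (fun u => PML.sat G (φs i) u = true)).card) l : ℚ)
        / ((G.neighIn v).card : ℚ) ^ l.length := by
    intro l
    induction l with
    | nil => simp [monValZ]
    | cons a l ih =>
      simp only [List.map_cons, List.prod_cons, ih, h2, monValZ, List.length_cons, pow_succ]
      push_cast
      field_simp
  rw [hlen, mW, List.map_append, List.prod_append, h3, List.map_replicate, List.prod_replicate, h1,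
    mul_pow, div_pow, one_pow, div_mul_div_comm, ← pow_add, Nat.add_sub_cancel' hl, mul_one, div_div]

theorem claim_ineq {k m : ℕ} (p : Fin k) (D : ℕ) (π : Fin m → Modality) (φs : Fin m → PML k)
    (hπ : ∀ i, π i = Modality.ein ∨ π i = Modality.eout) (hm : ∀ i, (φs i).md = 0)
    (c : PeanoIneq m) (hc : c.deg ≤ D) :
    Claim p D (fun G v => c.sat
      (fun i => ((G.modSem v (π i)).filter (fun u => PML.sat G (φs i) u = true)).card)) := by
  have hlen : ∀ i, (c.mon i).length ≤ D := fun i =>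
    (Finset.le_sup (f := fun i => (c.mon i).length) (Finset.mem_univ i)).trans hc
  let ws : Fin (c.K + 1) → List (Letter k) :=
    Fin.snoc (α := fun _ => List (Letter k)) (fun i => mW p D π φs (c.mon i)) (mW p D π φs [])
  let wt : Fin (c.K + 1) → ℚ := Fin.snoc (α := fun _ => ℚ) (fun i => (c.a i : ℚ)) (-(c.b : ℚ))
  let S : Feature k := fun G v => max 0 (0 + ∑ i, wt i * X p (ws i) G v)
  refine ⟨List.ofFn ws ++ [dW p D], Good.append ?_ (dW_good p D),
    fun G v => max 0 (0 + (1 * X p (dW p D) G v + (-1) * S G v + 0 * S G v)), ?_, ?_⟩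
  · intro w hw
    obtain ⟨i, rfl⟩ := (List.mem_ofFn' _ _).1 hw
    induction i using Fin.lastCases with
    | last =>
      simp only [ws, Fin.snoc_last]
      exact mW_good p D π φs hm [] (by simp) _ (by simp)
    | cast i =>
      simp only [ws, Fin.snoc_castSucc]
      exact mW_good p D π φs hm _ (hlen i) _ (by simp)
  · intro G v hr hv
    have hn : 1 ≤ G.n := Fin.pos v
    have hd : 1 ≤ (G.neighIn v).card :=
      Finset.card_pos.2 ⟨v, by simp [Graph.neighIn, hv.2]⟩
    have hdn : (G.neighIn v).card ≤ G.n := by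
      simpa using Finset.card_le_univ (G.neighIn v)
    have hd0 : 0 ≤ X p (dW p D) G v := (X_bd p _ G v).1
    simp only [dW_val p D G v hv.1] at hd0 ⊢
    set cnt : Fin m → ℕ :=
      fun i => ((G.modSem v (π i)).filter (fun u => PML.sat G (φs i) u = true)).card with hcnt
    set N : ℤ := (∑ i, c.a i * monValZ cnt (c.mon i)) - c.b with hN
    set Q : ℚ := (((G.neighIn v).card : ℚ) * G.n) ^ D with hQ
    have hn' : (1 : ℚ) ≤ G.n := by exact_mod_cast hn
    have hd' : (1 : ℚ) ≤ (G.neighIn v).card := by exact_mod_cast hd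
    have hdn' : ((G.neighIn v).card : ℚ) ≤ G.n := by exact_mod_cast hdn
    have hQ0 : 0 < Q := by positivity
    have hS : S G v = max 0 ((N : ℚ) / Q) := by
      simp only [S, zero_add]
      congr 1
      rw [Fin.sum_univ_castSucc]
      simp only [ws, wt, Fin.snoc_castSucc, Fin.snoc_last]
      rw [mW_val p D π φs hπ [] (by simp) G v hr hv]
      simp_rw [fun i => mW_val p D π φs hπ (c.mon i) (hlen i) G v hr hv]
      rw [hN]
      push_cast
      rw [sub_div, Finset.sum_div]
      simp only [← hcnt, ← hQ, monValZ, List.map_nil, List.prod_nil]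
      push_cast
      simp only [mul_div_assoc]
      ring
    rw [hS]
    by_cases hs : N ≤ 0
    · have : c.sat cnt = true := by simp only [PeanoIneq.sat, decide_eq_true_eq]; omega
      rw [if_pos this]
      have h0 : (N : ℚ) / Q ≤ 0 := div_nonpos_of_nonpos_of_nonneg (by exact_mod_cast hs) hQ0.le
      rw [max_eq_left h0]
      simpa using hd0
    · have : c.sat cnt = false := by simp only [PeanoIneq.sat, decide_eq_false_iff_not]; omega
      rw [if_neg (ne_true_of_eq_false this)]
      have h1 : (1 : ℚ) ≤ N := by exact_mod_cast (by omega : 1 ≤ N)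
      have h2 : 1 / (G.n : ℚ) ^ (2 * D) ≤ (N : ℚ) / Q := by
        apply div_le_div₀ (by linarith) h1 hQ0
        rw [hQ, pow_mul, sq]
        gcongr
      rw [max_eq_right (h2.trans' hd0)]
      apply max_eq_left
      linarith
  · intro t T hl hT
    have hS : Ext t T S := Ext.relu (fun i => X p (ws i)) (fun i => Ext.mem (hT _ (by
      apply List.mem_append_left; exact (List.mem_ofFn' _ _).2 ⟨i, rfl⟩))) wt 0
    exact Ext.relu3 (Ext.mem (hT _ (by simp))) hS hS 1 (-1) 0 0

theorem claim_peano {k m : ℕ} (p : Fin k) (D : ℕ) (π : Fin m → Modality) (φs : Fin m → PML k)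
    (hπ : ∀ i, π i = Modality.ein ∨ π i = Modality.eout) (hm : ∀ i, (φs i).md = 0)
    (ψ : PeanoFormula m) (hψ : ψ.deg ≤ D) :
    Claim p D (fun G v => ψ.sat
      (fun i => ((G.modSem v (π i)).filter (fun u => PML.sat G (φs i) u = true)).card)) := by
  induction ψ with
  | ineq c => exact claim_ineq p D π φs hπ hm c hψ
  | not ψ ih => exact claim_not (ih hψ)
  | and ψ₁ ψ₂ ih₁ ih₂ =>
    simp only [PeanoFormula.deg, max_le_iff] at hψ
    exact claim_and (ih₁ hψ.1) (ih₂ hψ.2)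

theorem claim_pml {k : ℕ} (p : Fin k) (D : ℕ) (φ : PML k) (hmd : φ.md ≤ 1) (hE : φ.onlyE)
    (hD : φ.deg ≤ D) : Claim p D (fun G v => PML.sat G φ v) := by
  induction φ with
  | prop i => exact claim_prop p D i
  | not φ ih => exact claim_not (ih hmd hE hD)
  | and φ₁ φ₂ ih₁ ih₂ =>
    simp only [PML.deg, PML.md, max_le_iff] at hD hmd
    exact claim_and (ih₁ hmd.1 hE.1 hD.1) (ih₂ hmd.2 hE.2 hD.2)
  | modal m π ψ φs ih =>
    simp only [PML.deg, PML.md, max_le_iff] at hD hmd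
    refine claim_peano p D π φs hE.1 (fun i => ?_) ψ hD.1
    have := Finset.le_sup (f := fun i => (φs i).md) (Finset.mem_univ i)
    omega


/-- there is a constant `C` such that every
`φ ∈ PML₁^E` is recognised, over regular pointed graphs whose focus is
strongly marked by colour `p`, by a mean MPNN with at most `C·(deg(φ)+1)`
layers with certainty `1/|V|^e` for some `e ≤ C·(deg(φ)+1)`. -/
theorem statement3 :
    ∃ C : ℕ, ∀ (k : ℕ) (p : Fin k) (φ : PML k), φ.md ≤ 1 → φ.onlyE →
      ∃ (M : MPNN) (e : ℕ), M.IsMean ∧ M.dims 0 = k ∧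
        M.L ≤ C * (φ.deg + 1) ∧ e ≤ C * (φ.deg + 1) ∧
        Recognises M φ (fun G v => G.Regular ∧ G.StronglyMarkedBy v p)
          (fun n => 1 / (n : ℚ) ^ e) := by
  refine ⟨2, fun k p φ hmd hE => ?_⟩
  obtain ⟨W, hW, h, hs, hx⟩ := claim_pml p φ.deg φ hmd hE le_rfl
  have h1 := R_words p φ.deg W hW φ.deg le_rfl
  have h2 := hx (2 * φ.deg)
    (labels k ∪ {f | ∃ w ∈ W, f = X p (w.drop (φ.deg - φ.deg))}) Set.subset_union_left
    (fun w hw => Or.inr ⟨w, hw, by simp⟩) _ subset_rfl h1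
  obtain ⟨M, hL, hM, h0, ho⟩ := R_final h2 h (Set.mem_insert _ _)
  refine ⟨M, 2 * φ.deg, hM, h0, by omega, by omega, fun G v hc => ?_⟩
  have := hs G v hc.1 hc.2
  rw [ho, this]
  constructor <;> intro hh <;> simp [hh]

end PMLMPNN
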